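/- arXiv:2507.05508 — 2 statements merged into one kernel-verified Lean document; each statement's English description precedes it below -/
import Mathlib

section
/- For every probability vector q : Fin 63 → ℝ (indexed by l = 1,…,63) with q_l > 0 for all l and ∑_l q_l = 1, one has ∑_{l=1}^{63} 2^{−2l} / q_l ≥ (1 − 2^{−63})², and the probability vector p_l = 2^{−l} / (1 − 2^{−63}) attains this minimum: ∑_{l=1}^{63} 2^{−2l} / p_l = (1 − 2^{−63})². -/
theorem sum_two_zpow_neg_succ (n : ℕ) :
    ∑ l : Fin n, (2 : ℝ) ^ (-(((l : ℕ) : ℤ) + 1)) = 1 - (2 : ℝ) ^ (-(n : ℤ)) := by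
  induction n with
  | zero => simp
  | succ n ih =>
    rw [Fin.sum_univ_castSucc]
    simp only [Fin.val_castSucc, Fin.val_last]
    rw [ih, Nat.cast_succ, neg_add, zpow_add₀ two_ne_zero]
    norm_num
    ring

theorem two_zpow_neg_two_mul (k : ℤ) : (2 : ℝ) ^ (-(2 * k)) = ((2 : ℝ) ^ (-k)) ^ 2 := by
  rw [sq, ← zpow_add₀ two_ne_zero]
  congr 1
  ring

/-- **Optimal level probabilities for the fixed-point MLMC estimator** (Lemma 2 of the paper).
Indexing levels `l = 1, …, 63` by `l : Fin 63` (so the level is `(l : ℕ) + 1`):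
every positive probability vector `q` satisfies
`∑_{l=1}^{63} 2^{−2l} / q_l ≥ (1 − 2^{−63})²`, and the probability vector
`p_l = 2^{−l} / (1 − 2^{−63})` is positive, sums to `1`, and attains this minimum. -/
theorem fixed_point_optimal_probabilities
    (p : Fin 63 → ℝ)
    (hp : ∀ l, p l = (2 : ℝ) ^ (-(((l : ℕ) : ℤ) + 1)) / (1 - (2 : ℝ) ^ (-63 : ℤ))) :
    (∀ q : Fin 63 → ℝ, (∀ l, 0 < q l) → ∑ l, q l = 1 →
      (1 - (2 : ℝ) ^ (-63 : ℤ)) ^ 2 ≤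
        ∑ l : Fin 63, (2 : ℝ) ^ (-(2 * (((l : ℕ) : ℤ) + 1))) / q l) ∧
    (∀ l, 0 < p l) ∧ (∑ l, p l = 1) ∧
    ∑ l : Fin 63, (2 : ℝ) ^ (-(2 * (((l : ℕ) : ℤ) + 1))) / p l = (1 - (2 : ℝ) ^ (-63 : ℤ)) ^ 2 := by
  have hsum : ∑ l : Fin 63, (2 : ℝ) ^ (-(((l : ℕ) : ℤ) + 1)) = 1 - (2 : ℝ) ^ (-63 : ℤ) :=
    sum_two_zpow_neg_succ 63
  have hpos : (0 : ℝ) < 1 - (2 : ℝ) ^ (-63 : ℤ) := by norm_num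
  simp only [two_zpow_neg_two_mul, hp]
  generalize 1 - (2 : ℝ) ^ (-63 : ℤ) = c at hsum hpos ⊢
  refine ⟨fun q hq hq1 => ?_, fun l => by positivity, ?_, ?_⟩
  · simpa only [hsum, hq1, div_one] using
      Finset.sq_sum_div_le_sum_sq_div Finset.univ
        (fun l : Fin 63 => (2 : ℝ) ^ (-(((l : ℕ) : ℤ) + 1))) (fun l _ => hq l)
  · rw [← Finset.sum_div, hsum, div_self hpos.ne']
  · have hterm (l : Fin 63) : ((2 : ℝ) ^ (-(((l : ℕ) : ℤ) + 1))) ^ 2 /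
        ((2 : ℝ) ^ (-(((l : ℕ) : ℤ) + 1)) / c) = (2 : ℝ) ^ (-(((l : ℕ) : ℤ) + 1)) * c := by
      have : (2 : ℝ) ^ (-(((l : ℕ) : ℤ) + 1)) ≠ 0 := by positivity
      generalize (2 : ℝ) ^ (-(((l : ℕ) : ℤ) + 1)) = x at this ⊢
      field_simp
    rw [Finset.sum_congr rfl fun l _ => hterm l, ← Finset.sum_mul, hsum, sq]
end

section
/- Let r > 0, let s, L ≥ 1 be natural numbers, d = sL, and let v ∈ ℝ^d have entries v(j) = a·exp(−(r/2)·j) for j = 0,1,…,d−1, where a ≠ 0. Define Δ_l = (∑_{j=s(l−1)}^{sl−1} v(j)²)^{1/2} for l = 1,…,L. Then (∑_{l=1}^{L} Δ_l)² = ‖v‖² · [(1 − e^{−rs})(1 − e^{−rd/2})²] / [(1 − e^{−rd})(1 − e^{−rs/2})²], where ‖v‖² = a²(1 − e^{−rd})/(1 − e^{−r}). -/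
open Real

theorem sum_range_exp_neg_mul {c : ℝ} (hc : 0 < c) (n : ℕ) :
    ∑ j ∈ Finset.range n, exp (-(c * j)) = (1 - exp (-(c * n))) / (1 - exp (-c)) := by
  have hpow (j : ℕ) : exp (-(c * j)) = exp (-c) ^ j := by
    rw [← Real.exp_nat_mul]
    ring_nf
  have hne : exp (-c) ≠ 1 := (Real.exp_lt_one_iff.mpr (neg_lt_zero.mpr hc)).ne
  simp_rw [hpow]
  rw [geom_sum_eq hne, ← neg_div_neg_eq, neg_sub, neg_sub]

/-- **Exact MLMC variance computation for exponentially decaying gradients**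
(proof of Lemma 4 of the paper). With entries `v j = a·e^{−(r/2)j}` for `j = 0,…,d−1`,
`d = sL`, and segment residual norms `Δ_l = (∑_{j=s(l−1)}^{sl−1} v(j)²)^{1/2}`
(levels `l = 1,…,L` encoded by `l = 0,…,L−1`, segment `j ∈ [sl, sl+s)`), one has
`(∑_l Δ_l)² = ‖v‖² (1−e^{−rs})(1−e^{−rd/2})² / [(1−e^{−rd})(1−e^{−rs/2})²]`,
where `‖v‖² = a²(1−e^{−rd})/(1−e^{−r})`. -/
theorem mlmc_exp_decay_exact_variance
    (r : ℝ) (hr : 0 < r)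
    (s L d : ℕ) (hs : 1 ≤ s) (hL : 1 ≤ L) (hd : d = s * L)
    (a : ℝ) (ha : a ≠ 0)
    (v : ℕ → ℝ) (hv : ∀ j, j < d → v j = a * exp (-(r / 2) * j))
    (Δ : ℕ → ℝ)
    (hΔ : ∀ l, l < L → Δ l = Real.sqrt (∑ j ∈ Finset.Ico (s * l) (s * l + s), v j ^ 2)) :
    (∑ l ∈ Finset.range L, Δ l) ^ 2
      = (∑ j ∈ Finset.range d, v j ^ 2) *
          ((1 - exp (-(r * s))) * (1 - exp (-(r * d) / 2)) ^ 2) /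
          ((1 - exp (-(r * d))) * (1 - exp (-(r * s) / 2)) ^ 2) ∧
    ∑ j ∈ Finset.range d, v j ^ 2 = a ^ 2 * (1 - exp (-(r * d))) / (1 - exp (-r)) := by
  have one_sub_pos {c : ℝ} (hc : 0 < c) : 0 < 1 - exp (-c) :=
    sub_pos.mpr (Real.exp_lt_one_iff.mpr (neg_lt_zero.mpr hc))
  have hs' : (0 : ℝ) < s := by exact_mod_cast hs
  have hL' : (0 : ℝ) < L := by exact_mod_cast hL
  have hdL : (d : ℝ) = s * L := by rw [hd]; push_cast; rfl
  have hrs : 0 < r * s := mul_pos hr hs'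
  have hrd : 0 < r * d := by rw [hdL]; positivity
  have hsq (j : ℕ) (hj : j < d) : v j ^ 2 = a ^ 2 * exp (-(r * j)) := by
    rw [hv j hj, mul_pow, ← Real.exp_nat_mul]
    congr 2
    push_cast
    ring
  have hnorm : ∑ j ∈ Finset.range d, v j ^ 2
      = a ^ 2 * (1 - exp (-(r * d))) / (1 - exp (-r)) := by
    rw [Finset.sum_congr rfl fun j hj => hsq j (Finset.mem_range.mp hj),
      ← Finset.mul_sum, sum_range_exp_neg_mul hr, mul_div_assoc]
  refine ⟨?_, hnorm⟩
  set C : ℝ := a ^ 2 * (1 - exp (-(r * s))) / (1 - exp (-r)) with hC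
  have hC0 : 0 ≤ C := by
    have h1 := one_sub_pos hrs
    have h2 := one_sub_pos hr
    positivity
  have hsegment (l : ℕ) (hl : l < L) : Δ l = √C * exp (-(r * s / 2 * l)) := by
    have hsum : ∑ j ∈ Finset.Ico (s * l) (s * l + s), v j ^ 2
        = C * exp (-(r * s / 2 * l)) ^ 2 := by
      have hterm (i : ℕ) (hi : i ∈ Finset.range s) :
          v (s * l + i) ^ 2 = a ^ 2 * exp (-(r * s / 2 * l)) ^ 2 * exp (-(r * i)) := by
        have hlt : s * l + i < d := by
          have := Finset.mem_range.mp hi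
          have : s * (l + 1) ≤ s * L := Nat.mul_le_mul_left s hl
          rw [hd]
          linarith
        rw [hsq _ hlt, ← Real.exp_nat_mul, mul_assoc, ← Real.exp_add]
        congr 2
        push_cast
        ring
      rw [Finset.sum_Ico_eq_sum_range, Nat.add_sub_cancel_left, Finset.sum_congr rfl hterm,
        ← Finset.mul_sum, sum_range_exp_neg_mul hr, hC]
      ring
    rw [hΔ l hl, hsum, Real.sqrt_mul hC0, Real.sqrt_sq (Real.exp_pos _).le]
  rw [Finset.sum_congr rfl fun l hl => hsegment l (Finset.mem_range.mp hl), ← Finset.mul_sum,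
    sum_range_exp_neg_mul (half_pos hrs), mul_pow, Real.sq_sqrt hC0, hnorm, hC]
  have e1 : -(r * s / 2 * L) = -(r * d) / 2 := by rw [hdL]; ring
  rw [e1, neg_div]
  have h1 := (one_sub_pos hr).ne'
  have h2 := (one_sub_pos hrd).ne'
  have h3 := (one_sub_pos (half_pos hrs)).ne'
  rw [neg_div]
  field_simp
end
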